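/- arXiv:2003.06391 — 2 statements merged into one kernel-verified Lean document; each statement's English description precedes it below -/
import Mathlib

section
/- If W ∈ ℂ^{2n×2n} is a normal skew-Hamiltonian matrix all of whose eigenvalues have nonzero imaginary part, then there exists a unitary symplectic matrix U ∈ ℂ^{2n×2n} and a diagonal D ∈ ℂ^{n×n} such that W = U [[D, 0], [0, D^H]] U^H. -/
open Matrix

noncomputable def Jmat (n : ℕ) : Matrix (Fin n ⊕ Fin n) (Fin n ⊕ Fin n) ℂ :=
  Matrix.fromBlocks 0 1 (-1) 0

lemma Jmat_conjTranspose (n : ℕ) : (Jmat n)ᴴ = -Jmat n := by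
  simp [Jmat, fromBlocks_conjTranspose, fromBlocks_neg]

lemma Jmat_mul_self (n : ℕ) : Jmat n * Jmat n = -1 := by
  simp [Jmat, fromBlocks_multiply, ← fromBlocks_one, fromBlocks_neg]

section Adjoint

open scoped ComplexOrder

variable {ι : Type*} [Fintype ι]

lemma star_dotProduct_mulVec_eq (A : Matrix ι ι ℂ) (x y : ι → ℂ) :
    star x ⬝ᵥ (A *ᵥ y) = star (Aᴴ *ᵥ x) ⬝ᵥ y := by
  rw [star_mulVec, conjTranspose_conjTranspose, dotProduct_mulVec]

/-- An eigenvector of a normal matrix is an eigenvector of its adjoint, with the conjugate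
eigenvalue. -/
lemma conjTranspose_mulVec_eq_of_normal [DecidableEq ι] {A : Matrix ι ι ℂ}
    (hA : A * Aᴴ = Aᴴ * A) {μ : ℂ} {v : ι → ℂ} (hv : A *ᵥ v = μ • v) :
    Aᴴ *ᵥ v = star μ • v := by
  set B : Matrix ι ι ℂ := A - μ • 1 with hB
  have hBH : Bᴴ = Aᴴ - star μ • 1 := by simp [hB, conjTranspose_sub, conjTranspose_smul]
  have hBv : B *ᵥ v = 0 := by simp [hB, sub_mulVec, smul_mulVec, hv]
  have hcomm : B * Bᴴ = Bᴴ * B := by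
    rw [hBH, hB]
    simp only [sub_mul, mul_sub, hA, smul_mul_assoc, mul_smul_comm, one_mul, mul_one,
      smul_sub, smul_comm μ (star μ)]
    abel
  have h0 : Bᴴ *ᵥ v = 0 := by
    rw [← dotProduct_star_self_eq_zero, ← star_dotProduct_mulVec_eq,
      mulVec_mulVec, hcomm, ← mulVec_mulVec, hBv, mulVec_zero, dotProduct_zero]
  rw [hBH, sub_mulVec, smul_mulVec, one_mulVec] at h0
  exact sub_eq_zero.mp h0

/-- A nonzero invariant subspace of a complex matrix contains a unit eigenvector. -/
lemma exists_unit_eigenvector_mem (A : Matrix ι ι ℂ) (p : Submodule ℂ (ι → ℂ)) (hp : p ≠ ⊥)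
    (hinv : ∀ v ∈ p, A *ᵥ v ∈ p) :
    ∃ v ∈ p, ∃ μ : ℂ, star v ⬝ᵥ v = 1 ∧ A *ᵥ v = μ • v := by
  have : Nontrivial p := Submodule.nontrivial_iff_ne_bot.mpr hp
  obtain ⟨μ, hμ⟩ := Module.End.exists_eigenvalue (A.mulVecLin.restrict hinv)
  obtain ⟨⟨w, hwp⟩, hw⟩ := hμ.exists_hasEigenvector
  have hwA : A *ᵥ w = μ • w := congrArg Subtype.val hw.apply_eq_smul
  have hw0 : w ≠ 0 := fun h => hw.2 (Subtype.ext h)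
  have hpos : 0 < star w ⬝ᵥ w := dotProduct_star_self_pos_iff.mpr hw0
  obtain ⟨r, hr, hrw⟩ : ∃ r : ℝ, 0 < r ∧ star w ⬝ᵥ w = (r : ℂ) :=
    RCLike.pos_iff_exists_ofReal.mp hpos |>.imp fun r h => ⟨h.1, h.2.symm⟩
  refine ⟨((√r)⁻¹ : ℂ) • w, p.smul_mem _ hwp, μ, ?_, ?_⟩
  · have hs : ((√r : ℝ) : ℂ) * (√r : ℝ) = r := by
      rw [← Complex.ofReal_mul, Real.mul_self_sqrt hr.le]
    have hs0 : ((√r : ℝ) : ℂ) ≠ 0 := by simpa using (Real.sqrt_pos.mpr hr).ne'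
    simp only [star_smul, smul_dotProduct, dotProduct_smul, hrw, smul_eq_mul, ← hs, star_inv₀,
      Complex.star_def, Complex.conj_ofReal]
    field_simp
  · rw [mulVec_smul, hwA, smul_comm]

end Adjoint

/-- A normal skew-Hamiltonian matrix without real eigenvalues has orthonormal eigenvectors
`u 0, …, u (k - 1)` spanning an isotropic subspace, for every `k ≤ n`. -/
lemma exists_orthonormal_isotropic_eigenvectors (n : ℕ)
    (W : Matrix (Fin n ⊕ Fin n) (Fin n ⊕ Fin n) ℂ)
    (hWJ : W * Jmat n = Jmat n * Wᴴ) (hWJ' : Wᴴ * Jmat n = Jmat n * W)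
    (hnormal : W * Wᴴ = Wᴴ * W)
    (heig : ∀ (μ : ℂ) (v : (Fin n ⊕ Fin n) → ℂ), v ≠ 0 → W *ᵥ v = μ • v → μ.im ≠ 0)
    (k : ℕ) (hk : k ≤ n) :
    ∃ (u : Fin k → (Fin n ⊕ Fin n) → ℂ) (d : Fin k → ℂ),
      (∀ i j, star (u i) ⬝ᵥ u j = if i = j then 1 else 0) ∧
      (∀ i j, star (u i) ⬝ᵥ (Jmat n *ᵥ u j) = 0) ∧
      ∀ i, W *ᵥ u i = d i • u i := by
  induction k with
  | zero => exact ⟨Fin.elim0, Fin.elim0, fun i => i.elim0, fun i => i.elim0, fun i => i.elim0⟩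
  | succ k ih =>
    obtain ⟨u, d, hon, hiso, hd⟩ := ih (by omega)
    have hdH i : Wᴴ *ᵥ u i = star (d i) • u i := conjTranspose_mulVec_eq_of_normal hnormal (hd i)
    let M : Matrix (Fin k ⊕ Fin k) (Fin n ⊕ Fin n) ℂ :=
      of (Sum.elim (fun i => star (u i)) fun i => star (Jmat n *ᵥ u i))
    have hM v : v ∈ M.mulVecLin.ker ↔
        (∀ i, star (u i) ⬝ᵥ v = 0) ∧ ∀ i, star (Jmat n *ᵥ u i) ⬝ᵥ v = 0 := by
      rw [LinearMap.mem_ker, mulVecLin_apply, funext_iff, Sum.forall]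
      rfl
    have hker : M.mulVecLin.ker ≠ ⊥ :=
      LinearMap.ker_ne_bot_of_finrank_lt (by simp; omega)
    obtain ⟨v, hv, μ, hv1, hvμ⟩ := exists_unit_eigenvector_mem W _ hker fun v hv => by
      rw [hM] at hv ⊢
      refine ⟨fun i => ?_, fun i => ?_⟩
      · rw [star_dotProduct_mulVec_eq, hdH, star_smul, smul_dotProduct, hv.1, smul_zero]
      · rw [star_dotProduct_mulVec_eq, mulVec_mulVec, hWJ', ← mulVec_mulVec, hd, mulVec_smul,
          star_smul, smul_dotProduct, hv.2, smul_zero]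
    obtain ⟨hvu, hvJ⟩ := (hM v).mp hv
    have hv0 : v ≠ 0 := by
      rintro rfl
      simp at hv1
    have hvH := conjTranspose_mulVec_eq_of_normal hnormal hvμ
    have hself : star v ⬝ᵥ (Jmat n *ᵥ v) = 0 := by
      have h : star v ⬝ᵥ (W *ᵥ (Jmat n *ᵥ v)) = star v ⬝ᵥ (W *ᵥ (Jmat n *ᵥ v)) := rfl
      conv_lhs at h =>
        rw [star_dotProduct_mulVec_eq, hvH, star_smul, star_star, smul_dotProduct]
      rw [mulVec_mulVec, hWJ, ← mulVec_mulVec, hvH, mulVec_smul, dotProduct_smul, smul_eq_mul,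
        smul_eq_mul] at h
      refine (mul_eq_mul_right_iff.mp h).resolve_left fun h' => heig μ v hv0 hvμ ?_
      exact Complex.conj_eq_iff_im.mp h'.symm
    have huv i : star v ⬝ᵥ u i = 0 := by
      rw [star_dotProduct, hvu, star_zero]
    have hJuv i : star v ⬝ᵥ (Jmat n *ᵥ u i) = 0 := by
      rw [star_dotProduct, hvJ, star_zero]
    have hJvu i : star (u i) ⬝ᵥ (Jmat n *ᵥ v) = 0 := by
      rw [star_dotProduct_mulVec_eq, Jmat_conjTranspose, neg_mulVec, star_neg, neg_dotProduct,
        hvJ, neg_zero]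
    refine ⟨Fin.cons v u, Fin.cons μ d, ?_, ?_, ?_⟩
    · intro i j
      cases i using Fin.cases <;> cases j using Fin.cases <;>
        simp [hv1, huv, hvu, hon, Fin.succ_ne_zero, (Fin.succ_ne_zero _).symm]
    · intro i j
      cases i using Fin.cases <;> cases j using Fin.cases <;> simp [hself, hJuv, hJvu, hiso]
    · intro i
      cases i using Fin.cases <;> simp [hvμ, hd]

theorem stmt12 (n : ℕ) (W : Matrix (Fin n ⊕ Fin n) (Fin n ⊕ Fin n) ℂ)
    (hsham : (Jmat n * W)ᴴ = -(Jmat n * W))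
    (hnormal : W * Wᴴ = Wᴴ * W)
    (heig : ∀ (μ : ℂ) (v : (Fin n ⊕ Fin n) → ℂ), v ≠ 0 → W.mulVec v = μ • v → μ.im ≠ 0) :
    ∃ (U : Matrix (Fin n ⊕ Fin n) (Fin n ⊕ Fin n) ℂ) (D : Matrix (Fin n) (Fin n) ℂ),
      Uᴴ * U = 1 ∧ Uᴴ * Jmat n * U = Jmat n ∧ (∀ i j, i ≠ j → D i j = 0) ∧
      W = U * Matrix.fromBlocks D 0 0 Dᴴ * Uᴴ := by
  have hJH := Jmat_conjTranspose n
  have hJJ := Jmat_mul_self n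
  have hWJ' : Wᴴ * Jmat n = Jmat n * W := by
    rw [conjTranspose_mul, hJH, mul_neg] at hsham
    exact neg_injective hsham
  have hWJ : W * Jmat n = Jmat n * Wᴴ := by
    have h := congrArg (fun A => Jmat n * A * Jmat n) hWJ'
    simp only [← Matrix.mul_assoc, hJJ] at h
    simpa [Matrix.mul_assoc, hJJ] using h.symm
  obtain ⟨u, d, hon, hiso, hd⟩ :=
    exists_orthonormal_isotropic_eigenvectors n W hWJ hWJ' hnormal heig n le_rfl
  have hdH i : Wᴴ *ᵥ u i = star (d i) • u i := conjTranspose_mulVec_eq_of_normal hnormal (hd i)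
  let X : Matrix (Fin n ⊕ Fin n) (Fin n) ℂ := (of u)ᵀ
  have hXX : Xᴴ * X = 1 := by
    ext i j
    rw [one_apply, ← hon i j]
    rfl
  have hXJX : Xᴴ * (Jmat n * X) = 0 := by
    ext i j
    rw [Matrix.zero_apply, ← hiso i j]
    rfl
  have hWX : W * X = X * diagonal d := by
    ext a i
    rw [mul_diagonal, mul_comm]
    exact congrFun (hd i) a
  have hWHX : Wᴴ * X = X * (diagonal d)ᴴ := by
    ext a i
    rw [diagonal_conjTranspose, mul_diagonal, mul_comm]
    exact congrFun (hdH i) a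
  have hJJX : Jmat n * (Jmat n * X) = -X := by
    rw [← Matrix.mul_assoc, hJJ, Matrix.neg_mul, Matrix.one_mul]
  let U := fromCols X (-(Jmat n * X))
  have hUH : Uᴴ = fromRows Xᴴ (Xᴴ * Jmat n) := by
    simp [U, conjTranspose_fromCols_eq_fromRows_conjTranspose, hJH]
  have hUU : Uᴴ * U = 1 := by
    rw [hUH, fromRows_mul_fromCols, ← fromBlocks_one]
    simp [Matrix.mul_assoc, hXX, hXJX, hJJX]
  refine ⟨U, diagonal d, hUU, ?_, fun i j h => diagonal_apply_ne _ h, ?_⟩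
  · rw [Matrix.mul_assoc, hUH, mul_fromCols, fromRows_mul_fromCols]
    simp only [Matrix.mul_assoc, Matrix.mul_neg, hXX, hXJX, hJJX, neg_neg]
    rfl
  · have hWU : W * U = U * fromBlocks (diagonal d) 0 0 (diagonal d)ᴴ := by
      rw [mul_fromCols, fromCols_mul_fromBlocks, hWX, Matrix.mul_neg, ← Matrix.mul_assoc, hWJ,
        Matrix.mul_assoc, hWHX]
      simp [Matrix.mul_assoc]
    rw [← hWU, Matrix.mul_assoc, mul_eq_one_comm.mp hUU, mul_one]
end

section
/- If A ∈ ℂ^{2n×2n} is a normal per-Hermitian matrix all of whose eigenvalues have nonzero imaginary part, then there exists a unitary perplectic matrix U ∈ ℂ^{2n×2n} and a diagonal D ∈ ℂ^{n×n} such that A = U [[D, 0], [0, F_n D^H F_n]] U^H. -/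
open Matrix

noncomputable def flipMat (m : ℕ) : Matrix (Fin m) (Fin m) ℂ :=
  Matrix.of fun i j => if (i : ℕ) + (j : ℕ) = m - 1 then 1 else 0

/-- The flip matrix on a `2n`-dimensional space indexed by `Fin n ⊕ Fin n`:
`F_{2n} = [[0, F_n], [F_n, 0]]`. -/
noncomputable def flip2 (n : ℕ) : Matrix (Fin n ⊕ Fin n) (Fin n ⊕ Fin n) ℂ :=
  Matrix.fromBlocks 0 (flipMat n) (flipMat n) 0

open scoped ComplexOrder in
/-- A normal matrix and its adjoint have the same eigenvectors, with conjugate eigenvalues. -/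
theorem conjTranspose_mulVec_of_normal {m : Type*} [Fintype m] [DecidableEq m]
    {A : Matrix m m ℂ} (hA : A * Aᴴ = Aᴴ * A) {μ : ℂ} {v : m → ℂ} (hv : A *ᵥ v = μ • v) :
    Aᴴ *ᵥ v = star μ • v := by
  set B : Matrix m m ℂ := A - μ • (1 : Matrix m m ℂ) with hB
  have hBH : Bᴴ = Aᴴ - star μ • (1 : Matrix m m ℂ) := by simp [hB]
  have hcomm : B * Bᴴ = Bᴴ * B := by
    rw [hBH, hB]
    simp only [sub_mul, mul_sub, hA, smul_mul_assoc, mul_smul_comm, one_mul, mul_one, smul_sub,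
      smul_comm μ (star μ)]
    abel
  have hBv : B *ᵥ v = 0 := by simp [hB, sub_mulVec, hv, smul_mulVec]
  have h0 : Bᴴ *ᵥ v = 0 := by
    rw [← dotProduct_star_self_eq_zero, star_mulVec, conjTranspose_conjTranspose,
      ← dotProduct_mulVec, mulVec_mulVec, hcomm, ← mulVec_mulVec, hBv]
    simp
  rw [hBH, sub_mulVec, smul_mulVec, one_mulVec, sub_eq_zero] at h0
  exact h0

theorem star_dotProduct_mulVec_comm {m : Type*} [Fintype m] (A : Matrix m m ℂ) (v w : m → ℂ) :
    star v ⬝ᵥ A *ᵥ w = star (Aᴴ *ᵥ v) ⬝ᵥ w := by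
  rw [star_mulVec, conjTranspose_conjTranspose, dotProduct_mulVec]

/-- Fewer than `card m` eigenvectors of `Aᴴ` always leave room for an eigenvector of `A`
orthogonal to all of them. -/
theorem exists_eigenvector_orthogonal {m ι : Type*} [Fintype m] [DecidableEq m] [Fintype ι]
    (A : Matrix m m ℂ) (w : ι → m → ℂ) (c : ι → ℂ) (hw : ∀ i, Aᴴ *ᵥ w i = c i • w i)
    (hcard : Fintype.card ι < Fintype.card m) :
    ∃ (μ : ℂ) (v : m → ℂ), v ≠ 0 ∧ A *ᵥ v = μ • v ∧ ∀ i, star (w i) ⬝ᵥ v = 0 := by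
  let M : Matrix ι m ℂ := Matrix.of fun i => star (w i)
  let K := LinearMap.ker M.mulVecLin
  have hmem (x : m → ℂ) : x ∈ K ↔ ∀ i, star (w i) ⬝ᵥ x = 0 := by
    simp only [K, LinearMap.mem_ker, mulVecLin_apply, funext_iff]
    rfl
  have hK : K ≠ ⊥ := LinearMap.ker_ne_bot_of_finrank_lt (by simpa using hcard)
  have : Nontrivial K := Submodule.nontrivial_iff_ne_bot.2 hK
  have hinv : ∀ x ∈ K, A.mulVecLin x ∈ K := by
    intro x hx
    rw [hmem] at hx ⊢
    intro i
    rw [mulVecLin_apply, star_dotProduct_mulVec_comm, hw, star_smul, smul_dotProduct, hx, smul_zero]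
  obtain ⟨μ, hμ⟩ := Module.End.exists_eigenvalue (A.mulVecLin.restrict hinv)
  obtain ⟨v, hv⟩ := hμ.exists_hasEigenvector
  refine ⟨μ, v, by simpa using hv.2, ?_, (hmem v).1 v.2⟩
  simpa using congrArg Subtype.val hv.apply_eq_smul

open scoped ComplexOrder in
theorem exists_normalized {m : Type*} [Fintype m] {v : m → ℂ} (hv : v ≠ 0) :
    ∃ c : ℂ, star (c • v) ⬝ᵥ (c • v) = 1 := by
  have hpos : 0 < star v ⬝ᵥ v := dotProduct_star_self_pos_iff.2 hv
  obtain ⟨hre, him⟩ := Complex.pos_iff.1 hpos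
  have hr : star v ⬝ᵥ v = ((star v ⬝ᵥ v).re : ℂ) := Complex.ext rfl (by simp [← him])
  set r := (star v ⬝ᵥ v).re
  refine ⟨((√r)⁻¹ : ℝ), ?_⟩
  rw [star_smul, smul_dotProduct, dotProduct_smul, hr]
  simp only [Complex.star_def, Complex.conj_ofReal, smul_eq_mul]
  norm_cast
  have : √r ≠ 0 := (Real.sqrt_pos.2 hre).ne'
  field_simp
  exact (Real.sq_sqrt hre.le).symm

theorem flipMat_eq_submatrix (n : ℕ) :
    flipMat n = (1 : Matrix (Fin n) (Fin n) ℂ).submatrix Fin.rev id := by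
  ext i j
  simp only [flipMat, of_apply, submatrix_apply, one_apply, id, Fin.ext_iff, Fin.val_rev]
  congr 1
  apply propext
  omega

theorem flipMat_mul_self (n : ℕ) : flipMat n * flipMat n = 1 := by
  rw [flipMat_eq_submatrix]
  ext i j
  rw [mul_apply, Finset.sum_eq_single i.rev] <;> simp +contextual [one_apply, eq_comm]

theorem flipMat_conjTranspose (n : ℕ) : (flipMat n)ᴴ = flipMat n := by
  ext i j
  simp only [flipMat, conjTranspose_apply, of_apply, add_comm (j : ℕ)]
  split_ifs <;> simp

theorem flip2_mul_self (n : ℕ) : flip2 n * flip2 n = 1 := by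
  simp [flip2, fromBlocks_multiply, flipMat_mul_self]

theorem flip2_conjTranspose (n : ℕ) : (flip2 n)ᴴ = flip2 n := by
  simp [flip2, fromBlocks_conjTranspose, flipMat_conjTranspose]

/-- A normal matrix `A` with `A * F = F * Aᴴ` for a Hermitian involution `F` and without real
eigenvalues has an orthonormal family of eigenvectors belonging to the open upper half plane, of
any size up to half the dimension. -/
theorem exists_orthonormal_eigenvectors {m : Type*} [Fintype m] [DecidableEq m]
    {A F : Matrix m m ℂ} (hF : F * F = 1) (hFH : Fᴴ = F) (hAF : A * F = F * Aᴴ)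
    (hA : A * Aᴴ = Aᴴ * A) (heig : ∀ (μ : ℂ) (v : m → ℂ), v ≠ 0 → A *ᵥ v = μ • v → μ.im ≠ 0)
    (k : ℕ) (hk : 2 * k ≤ Fintype.card m) :
    ∃ (v : Fin k → m → ℂ) (μ : Fin k → ℂ), (∀ i j, star (v i) ⬝ᵥ v j = if i = j then 1 else 0) ∧
      (∀ i, A *ᵥ v i = μ i • v i) ∧ ∀ i, 0 < (μ i).im := by
  have hflip {μ : ℂ} {x : m → ℂ} (hx : A *ᵥ x = μ • x) : A *ᵥ (F *ᵥ x) = star μ • (F *ᵥ x) := by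
    rw [mulVec_mulVec, hAF, ← mulVec_mulVec, conjTranspose_mulVec_of_normal hA hx, mulVec_smul]
  induction k with
  | zero => exact ⟨Fin.elim0, Fin.elim0, fun i => i.elim0, fun i => i.elim0, fun i => i.elim0⟩
  | succ k ih =>
    obtain ⟨v, μ, hv, hμ, hpos⟩ := ih (by omega)
    obtain ⟨ν, x, hx0, hx, hort⟩ := exists_eigenvector_orthogonal A
      (Sum.elim v fun i => F *ᵥ v i) (Sum.elim (fun i => star (μ i)) fun i => star (star (μ i)))
      (by
        rintro (i | i)
        · exact conjTranspose_mulVec_of_normal hA (hμ i)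
        · exact conjTranspose_mulVec_of_normal hA (hflip (hμ i)))
      (by simp; omega)
    obtain ⟨ν, x, hx0, hx, hort, hν⟩ : ∃ (ν : ℂ) (x : m → ℂ), x ≠ 0 ∧ A *ᵥ x = ν • x ∧
        (∀ i, star (v i) ⬝ᵥ x = 0) ∧ 0 < ν.im := by
      rcases (heig ν x hx0 hx).lt_or_gt with h | h
      · refine ⟨star ν, F *ᵥ x, fun h0 => hx0 ?_, hflip hx, fun i => ?_, by simpa using h⟩
        · rw [← one_mulVec x, ← hF, ← mulVec_mulVec, h0, mulVec_zero]
        · rw [star_dotProduct_mulVec_comm, hFH]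
          exact hort (Sum.inr i)
      · exact ⟨ν, x, hx0, hx, fun i => hort (Sum.inl i), h⟩
    obtain ⟨c, hc⟩ := exists_normalized hx0
    have hvx (i) : star (v i) ⬝ᵥ (c • x) = 0 := by rw [dotProduct_smul, hort, smul_zero]
    have hxv (i) : star (c • x) ⬝ᵥ v i = 0 := by
      rw [← star_eq_zero, ← star_dotProduct_star, star_star, hvx]
    refine ⟨Fin.cons (c • x) v, Fin.cons ν μ, fun i j => ?_, fun i => ?_, fun i => ?_⟩
    · refine Fin.cases ?_ (fun i => ?_) i <;> refine Fin.cases ?_ (fun j => ?_) j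
      · simpa using hc
      · simpa [(Fin.succ_ne_zero j).symm] using hxv j
      · simpa using hvx i
      · simpa using hv i j
    · refine Fin.cases ?_ (fun i => ?_) i
      · simp [mulVec_smul, hx, smul_comm c]
      · simpa using hμ i
    · refine Fin.cases ?_ (fun i => ?_) i
      · simpa using hν
      · simpa using hpos i

theorem star_dotProduct_eq_zero_of_normal {m : Type*} [Fintype m] [DecidableEq m]
    {A : Matrix m m ℂ} (hA : A * Aᴴ = Aᴴ * A) {μ ν : ℂ} {v w : m → ℂ} (hv : A *ᵥ v = μ • v)
    (hw : A *ᵥ w = ν • w) (hne : μ ≠ ν) : star v ⬝ᵥ w = 0 := by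
  have h := star_dotProduct_mulVec_comm A v w
  rw [hw, conjTranspose_mulVec_of_normal hA hv, star_smul, star_star, smul_dotProduct,
    dotProduct_smul, smul_eq_mul, smul_eq_mul] at h
  exact (mul_eq_mul_right_iff.1 h).resolve_left hne.symm

theorem stmt13 (n : ℕ) (A : Matrix (Fin n ⊕ Fin n) (Fin n ⊕ Fin n) ℂ)
    (hper : (flip2 n * A)ᴴ = flip2 n * A)
    (hnormal : A * Aᴴ = Aᴴ * A)
    (heig : ∀ (μ : ℂ) (v : (Fin n ⊕ Fin n) → ℂ), v ≠ 0 → A.mulVec v = μ • v → μ.im ≠ 0) :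
    ∃ (U : Matrix (Fin n ⊕ Fin n) (Fin n ⊕ Fin n) ℂ) (D : Matrix (Fin n) (Fin n) ℂ),
      Uᴴ * U = 1 ∧ Uᴴ * flip2 n * U = flip2 n ∧ (∀ i j, i ≠ j → D i j = 0) ∧
      A = U * Matrix.fromBlocks D 0 0 (flipMat n * Dᴴ * flipMat n) * Uᴴ := by
  have hF := flip2_mul_self n
  have hFH := flip2_conjTranspose n
  have hJ := flipMat_mul_self n
  have hJH := flipMat_conjTranspose n
  have hflip2 : flip2 n = fromBlocks 0 (flipMat n) (flipMat n) 0 := rfl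
  set F := flip2 n
  set J := flipMat n
  have hAF : A * F = F * Aᴴ := by
    rw [conjTranspose_mul, hFH] at hper
    calc A * F = F * (F * A) * F := by rw [← mul_assoc, hF, one_mul]
      _ = F * Aᴴ := by rw [← hper, mul_assoc, mul_assoc, hF, mul_one]
  obtain ⟨v, μ, hv, hμ, hpos⟩ :=
    exists_orthonormal_eigenvectors hF hFH hAF hnormal heig n (by simp; omega)
  let V : Matrix (Fin n ⊕ Fin n) (Fin n) ℂ := (Matrix.of v)ᵀ
  have hcol (B : Matrix (Fin n ⊕ Fin n) (Fin n ⊕ Fin n) ℂ) (i j) :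
      (B * V) i j = (B *ᵥ v j) i := rfl
  have hgram (B : Matrix (Fin n ⊕ Fin n) (Fin n ⊕ Fin n) ℂ) (i j) :
      (Vᴴ * (B * V)) i j = star (v i) ⬝ᵥ B *ᵥ v j := rfl
  have hVV : Vᴴ * V = 1 := by
    ext i j
    exact (hv i j).trans (one_apply ..).symm
  have hVFV : Vᴴ * (F * V) = 0 := by
    ext i j
    rw [hgram, Matrix.zero_apply]
    refine star_dotProduct_eq_zero_of_normal hnormal (ν := star (μ j)) (hμ i) ?_ fun h => ?_
    · rw [mulVec_mulVec, hAF, ← mulVec_mulVec, conjTranspose_mulVec_of_normal hnormal (hμ j),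
        mulVec_smul]
    · have := congrArg Complex.im h
      simp only [Complex.star_def, Complex.conj_im] at this
      linarith [hpos i, hpos j]
  have hAV : A * V = V * diagonal μ := by
    ext i j
    rw [hcol, hμ, mul_diagonal]
    exact mul_comm _ _
  have hAHV : Aᴴ * V = V * (diagonal μ)ᴴ := by
    ext i j
    rw [hcol, conjTranspose_mulVec_of_normal hnormal (hμ j), diagonal_conjTranspose, mul_diagonal]
    exact mul_comm _ _
  have hFF {l : Type} (X : Matrix (Fin n ⊕ Fin n) l ℂ) : F * (F * X) = X := by
    rw [← Matrix.mul_assoc, hF, Matrix.one_mul]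
  have hJJ (X : Matrix (Fin n) (Fin n) ℂ) : J * (J * X) = X := by
    rw [← mul_assoc, hJ, one_mul]
  let U := fromCols V (F * (V * J))
  have hUH : Uᴴ = fromRows Vᴴ (J * (Vᴴ * F)) := by
    simp only [U, conjTranspose_fromCols_eq_fromRows_conjTranspose, conjTranspose_mul, hJH, hFH,
      Matrix.mul_assoc]
  have hVV' (X : Matrix (Fin n) (Fin n) ℂ) : Vᴴ * (V * X) = X := by
    rw [← Matrix.mul_assoc, hVV, one_mul]
  have hVFV' (X : Matrix (Fin n) (Fin n) ℂ) : Vᴴ * (F * (V * X)) = 0 := by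
    rw [← Matrix.mul_assoc F, ← Matrix.mul_assoc, hVFV, zero_mul]
  have hUU : Uᴴ * U = 1 := by
    rw [hUH]
    simp only [U, fromRows_mul_fromCols, Matrix.mul_assoc, hVV, hVFV, hVFV', hFF, hVV', hJ,
      Matrix.mul_zero, fromBlocks_one]
  refine ⟨U, diagonal μ, hUU, ?_, fun i j h => diagonal_apply_ne _ h, ?_⟩
  · have hFU : F * U = fromCols (F * V) (V * J) := by simp only [U, mul_fromCols, hFF]
    rw [Matrix.mul_assoc, hFU, hUH]
    refine Eq.trans ?_ hflip2.symm
    simp only [fromRows_mul_fromCols, Matrix.mul_assoc, hVV, hVFV, hVFV', hFF, hVV',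
      Matrix.mul_zero, Matrix.mul_one]
  · have hAU : A * U = U * fromBlocks (diagonal μ) 0 0 (J * (diagonal μ)ᴴ * J) := by
      simp only [U, mul_fromCols, fromCols_mul_fromBlocks, Matrix.mul_zero, add_zero, zero_add,
        Matrix.mul_assoc, hJJ, hAV]
      rw [← Matrix.mul_assoc A, hAF, Matrix.mul_assoc F, ← Matrix.mul_assoc Aᴴ, hAHV,
        Matrix.mul_assoc V]
    rw [← hAU, mul_assoc, mul_eq_one_comm.1 hUU, mul_one]
end
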